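/- Let ρ_{BC|A} be the CJ channel operator induced by a common-cause dilation (a unitary U from inputs λB × a × λC to outputs b × d × c with density matrices ρ_{λB}, ρ_{λC}, where λB has no causal influence on C and λC has no causal influence on B). Then ρ_{BC|A} admits a common-cause block form. (Theorem 2/3, implication from condition 1 to condition 4, proved in the appendix.) -/

import Mathlib

open Matrix BigOperators
open scoped ComplexOrder

noncomputable section

/-- Partial trace over the first tensor factor. -/
def ptrace₁ {α β : Type*} [Fintype α] (M : Matrix (α × β) (α × β) ℂ) : Matrix β β ℂ :=
  Matrix.of fun j j' => ∑ i, M (i, j) (i, j')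

/-- Partial trace over the second tensor factor. -/
def ptrace₂ {α β : Type*} [Fintype β] (M : Matrix (α × β) (α × β) ℂ) : Matrix α α ℂ :=
  Matrix.of fun i i' => ∑ j, M (i, j) (i', j)

/-- `M` is a Choi–Jamiołkowski channel operator from `a` to `b`: positive semidefinite with
partial trace over the output equal to the identity. -/
def IsCJChannel {b a : Type*} [Fintype b] [Fintype a] [DecidableEq a]
    (M : Matrix (b × a) (b × a) ℂ) : Prop :=
  M.PosSemidef ∧ ptrace₁ M = 1

/-- The marginal `ρ_{B|A}` of a channel operator `ρ_{BC|A}` (partial trace over `C`). -/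
def margB {b c a : Type*} [Fintype c] (ρ : Matrix ((b × c) × a) ((b × c) × a) ℂ) :
    Matrix (b × a) (b × a) ℂ :=
  Matrix.of fun p q => ∑ γ, ρ ((p.1, γ), p.2) ((q.1, γ), q.2)

/-- The marginal `ρ_{C|A}` of a channel operator `ρ_{BC|A}` (partial trace over `B`). -/
def margC {b c a : Type*} [Fintype b] (ρ : Matrix ((b × c) × a) ((b × c) × a) ℂ) :
    Matrix (c × a) (c × a) ℂ :=
  Matrix.of fun p q => ∑ β, ρ ((β, p.1), p.2) ((β, q.1), q.2)

/-- Extension `↑ρ_{B|A}` of a marginal to the full space, tensoring with the identity on `C`. -/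
def extB {b c a : Type*} [DecidableEq c] (M : Matrix (b × a) (b × a) ℂ) :
    Matrix ((b × c) × a) ((b × c) × a) ℂ :=
  Matrix.of fun p q => M (p.1.1, p.2) (q.1.1, q.2) * (if p.1.2 = q.1.2 then 1 else 0)

/-- Extension `↑ρ_{C|A}` of a marginal to the full space, tensoring with the identity on `B`. -/
def extC {b c a : Type*} [DecidableEq b] (M : Matrix (c × a) (c × a) ℂ) :
    Matrix ((b × c) × a) ((b × c) × a) ℂ :=
  Matrix.of fun p q => M (p.1.2, p.2) (q.1.2, q.2) * (if p.1.1 = q.1.1 then 1 else 0)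

/-- The Choi–Jamiołkowski operator of a (unitary) matrix `U`. -/
def cjOf {y x : Type*} (U : Matrix y x ℂ) : Matrix (y × x) (y × x) ℂ :=
  Matrix.of fun p q => U p.1 p.2 * star (U q.1 q.2)

/-- A (possibly rectangular-typed) matrix is unitary if both `U Uᴴ = 1` and `Uᴴ U = 1`. -/
def IsUnitaryMat {y x : Type*} [Fintype y] [Fintype x] [DecidableEq y] [DecidableEq x]
    (U : Matrix y x ℂ) : Prop :=
  U * Uᴴ = 1 ∧ Uᴴ * U = 1

/-- von Neumann entropy of a matrix (junk value `0` if not Hermitian);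
`Real.log 0 = 0` gives the usual convention `0 log 0 = 0`. -/
def vNEntropy {n : Type*} [Fintype n] (M : Matrix n n ℂ) : ℝ :=
  letI := Classical.decEq n
  if h : M.IsHermitian then -∑ i, h.eigenvalues i * Real.log (h.eigenvalues i) else 0

/-- Quantum conditional mutual information `I(B:C|A)` of a matrix on `(b × c) × a`,
with systems grouped as `B`, `C`, `A`. -/
def qcmiBCA {b c a : Type*} [Fintype b] [Fintype c] [Fintype a]
    (ρ : Matrix ((b × c) × a) ((b × c) × a) ℂ) : ℝ :=
  vNEntropy (margB ρ) + vNEntropy (margC ρ) - vNEntropy ρ - vNEntropy (ptrace₁ ρ)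

/-- Conjugation of `ρ` on its `A` indices by a matrix `V` from `a` to `σa`. -/
def conjOnA {o σa a : Type*} [Fintype a] (ρ : Matrix (o × a) (o × a) ℂ)
    (V : Matrix σa a ℂ) : Matrix (o × σa) (o × σa) ℂ :=
  Matrix.of fun p q => ∑ x : a, ∑ x' : a, V p.2 x * ρ (p.1, x) (q.1, x') * star (V q.2 x')

section
variable {b c a : Type*} [Fintype b] [Fintype c] [Fintype a]
  [DecidableEq a] [DecidableEq b] [DecidableEq c]
  [Nonempty a] [Nonempty b] [Nonempty c]

/-- A common-cause dilation of a channel operator `ρ_{BC|A}`: a unitary `U` from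
`λB × A × λC` to `B × D × C` together with input states on the ancillas, such that the
induced channel is `ρ`, `λB` has no causal influence on `C`, and `λC` has no causal
influence on `B`. -/
structure CommonCauseDilation (ρ : Matrix ((b × c) × a) ((b × c) × a) ℂ) where
  lamB : Type
  lamC : Type
  d : Type
  [fintlamB : Fintype lamB]
  [fintlamC : Fintype lamC]
  [fintd : Fintype d]
  [nonemptylamB : Nonempty lamB]
  [nonemptylamC : Nonempty lamC]
  [nonemptyd : Nonempty d]
  [deceqlamB : DecidableEq lamB]
  [deceqlamC : DecidableEq lamC]
  [deceqd : DecidableEq d]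
  card_eq : Fintype.card lamB * Fintype.card a * Fintype.card lamC =
      Fintype.card b * Fintype.card d * Fintype.card c
  U : Matrix (b × d × c) (lamB × a × lamC) ℂ
  hU : IsUnitaryMat U
  ρlamB : Matrix lamB lamB ℂ
  ρlamC : Matrix lamC lamC ℂ
  hρlamB : ρlamB.PosSemidef ∧ ρlamB.trace = 1
  hρlamC : ρlamC.PosSemidef ∧ ρlamC.trace = 1
  induced : ∀ (β β' : b) (γ γ' : c) (i i' : a),
    ρ ((β, γ), i) ((β', γ'), i') =
      ∑ δ : d, ∑ l : lamB, ∑ l' : lamB, ∑ m : lamC, ∑ m' : lamC,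
        U (β, δ, γ) (l, i, m) * ρlamB l l' * ρlamC m m' * star (U (β', δ, γ') (l', i', m'))
  no_influence_lamB_on_C : ∃ σ : Matrix (c × (a × lamC)) (c × (a × lamC)) ℂ,
    ∀ (γ γ' : c) (l l' : lamB) (i i' : a) (m m' : lamC),
      (∑ β : b, ∑ δ : d, cjOf U ((β, δ, γ), (l, i, m)) ((β, δ, γ'), (l', i', m'))) =
        (if l = l' then 1 else 0) * σ (γ, (i, m)) (γ', (i', m'))
  no_influence_lamC_on_B : ∃ τ : Matrix (b × (lamB × a)) (b × (lamB × a)) ℂ,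
    ∀ (β β' : b) (l l' : lamB) (i i' : a) (m m' : lamC),
      (∑ δ : d, ∑ γ : c, cjOf U ((β, δ, γ), (l, i, m)) ((β', δ, γ), (l', i', m'))) =
        (if m = m' then 1 else 0) * τ (β, (l, i)) (β', (l', i'))

/-- A common-cause block form for a channel operator `ρ_{BC|A}`: a unitary decomposition
of the input space as a direct sum of tensor products, with the channel factorizing
blockwise into a `B`-channel and a `C`-channel. -/
structure CommonCauseBlockForm (ρ : Matrix ((b × c) × a) ((b × c) × a) ℂ) where
  ι : Type
  [fintι : Fintype ι]
  [deceqι : DecidableEq ι]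
  m : ι → ℕ
  n : ι → ℕ
  card_eq : ∑ i : ι, m i * n i = Fintype.card a
  V : Matrix (Σ i : ι, Fin (m i) × Fin (n i)) a ℂ
  hV : IsUnitaryMat V
  ρB : ∀ i : ι, Matrix (b × Fin (m i)) (b × Fin (m i)) ℂ
  ρC : ∀ i : ι, Matrix (c × Fin (n i)) (c × Fin (n i)) ℂ
  hρB : ∀ i, (ρB i).PosSemidef ∧ ptrace₁ (ρB i) = 1
  hρC : ∀ i, (ρC i).PosSemidef ∧ ptrace₁ (ρC i) = 1
  offdiag : ∀ (β β' : b) (γ γ' : c) (s t : Σ i : ι, Fin (m i) × Fin (n i)), s.1 ≠ t.1 →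
    conjOnA ρ V ((β, γ), s) ((β', γ'), t) = 0
  diag : ∀ (i : ι) (μ μ' : Fin (m i)) (ν ν' : Fin (n i)) (β β' : b) (γ γ' : c),
    conjOnA ρ V ((β, γ), ⟨i, (μ, ν)⟩) ((β', γ'), ⟨i, (μ', ν')⟩) =
      ρB i (β, μ) (β', μ') * ρC i (γ, ν) (γ', ν')

section
variable {E : Type*} [NormedAddCommGroup E] [InnerProductSpace ℂ E] [FiniteDimensional ℂ E]

open scoped InnerProductSpace in
/-- Schur's lemma for intertwiners out of an irreducible subspace. -/
theorem exists_inner_intertwiners_eq_smul {κ : Type*} (T : κ → E →ₗ[ℂ] E)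
    (hT : ∀ k, ∃ k', ∀ x y, ⟪T k x, y⟫_ℂ = ⟪x, T k' y⟫_ℂ)
    (K : Submodule ℂ E) (hK : K ≠ ⊥) (hKT : ∀ k, ∀ x ∈ K, T k x ∈ K)
    (hmin : ∀ L ≤ K, L ≠ ⊥ → (∀ k, ∀ x ∈ L, T k x ∈ L) → L = K)
    (f g : K →ₗ[ℂ] E)
    (hf : ∀ k (x : K), f ⟨T k x, hKT k x x.2⟩ = T k (f x))
    (hg : ∀ k (x : K), g ⟨T k x, hKT k x x.2⟩ = T k (g x)) :
    ∃ z : ℂ, ∀ x y : K, ⟪f x, g y⟫_ℂ = z * ⟪(x : E), y⟫_ℂ := by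
  have : Nontrivial K := Submodule.nontrivial_iff_ne_bot.mpr hK
  set h : Module.End ℂ K := LinearMap.adjoint f ∘ₗ g with hh
  have hinner : ∀ x y : K, ⟪x, h y⟫_ℂ = ⟪f x, g y⟫_ℂ := fun x y => by
    simp [hh, LinearMap.adjoint_inner_right]
  have hcomm : ∀ k (x : K), h ⟨T k x, hKT k x x.2⟩ = ⟨T k (h x), hKT k _ (h x).2⟩ := by
    intro k x
    refine ext_inner_left ℂ fun y => ?_
    obtain ⟨k', hk'⟩ := hT k
    have hk'' : ∀ x y, ⟪x, T k y⟫_ℂ = ⟪T k' x, y⟫_ℂ := fun x y => by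
      rw [← inner_conj_symm, hk', inner_conj_symm]
    rw [hinner, hg, hk'', ← hf, ← hinner]
    simp only [Submodule.coe_inner]
    rw [hk'']
  obtain ⟨z, hz⟩ := Module.End.exists_eigenvalue h
  have htop : (Module.End.eigenspace h z).map K.subtype = K := by
    refine hmin _ (Submodule.map_subtype_le _ _) ?_ ?_
    · intro h0
      exact hz (Submodule.map_injective_of_injective K.subtype_injective (by simpa using h0))
    · rintro k _ ⟨x, hx, rfl⟩
      refine ⟨⟨T k x, hKT k x x.2⟩, ?_, rfl⟩
      rw [SetLike.mem_coe, Module.End.mem_eigenspace_iff] at hx ⊢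
      rw [hcomm, hx]
      ext
      simp
  refine ⟨z, fun x y => ?_⟩
  have hy : (y : E) ∈ (Module.End.eigenspace h z).map K.subtype := by
    rw [htop]; exact y.2
  obtain ⟨y', hy', hyy⟩ := hy
  obtain rfl : y' = y := Subtype.ext hyy
  rw [SetLike.mem_coe, Module.End.mem_eigenspace_iff] at hy'
  rw [← hinner, hy', inner_smul_right, Submodule.coe_inner]

open scoped InnerProductSpace in
/-- The isotypic component of an irreducible subspace `K`, within a subspace `W` invariant under
two commuting families: it has an orthonormal basis on which the two families act on separate
tensor factors. -/
theorem exists_isotypic_component {κ κ' : Type*} (T : κ → E →ₗ[ℂ] E) (S : κ' → E →ₗ[ℂ] E)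
    (hT : ∀ k, ∃ k', ∀ x y, ⟪T k x, y⟫_ℂ = ⟪x, T k' y⟫_ℂ)
    (hTS : ∀ k k' x, T k (S k' x) = S k' (T k x))
    (W : Submodule ℂ E) (hW : W ≠ ⊥) (hWT : ∀ k, ∀ x ∈ W, T k x ∈ W)
    (hWS : ∀ k, ∀ x ∈ W, S k x ∈ W) :
    ∃ (m n : ℕ) (e : Fin m × Fin n → E), 0 < m ∧ 0 < n ∧ Orthonormal ℂ e ∧ (∀ p, e p ∈ W) ∧
      (∀ k, ∃ t : Matrix (Fin m) (Fin m) ℂ, ∀ μ ν,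
        T k (e (μ, ν)) = ∑ μ', t μ' μ • e (μ', ν)) ∧
      (∀ k, ∃ s : Matrix (Fin n) (Fin n) ℂ, ∀ μ ν,
        S k (e (μ, ν)) = ∑ ν', s ν' ν • e (μ, ν')) := by
  obtain ⟨K, ⟨hKW, hK, hKT⟩, hKmin⟩ := exists_minimal_of_wellFoundedLT
    (fun K : Submodule ℂ E => K ≤ W ∧ K ≠ ⊥ ∧ ∀ k, ∀ x ∈ K, T k x ∈ K) ⟨W, le_rfl, hW, hWT⟩
  have hmin : ∀ L ≤ K, L ≠ ⊥ → (∀ k, ∀ x ∈ L, T k x ∈ L) → L = K := fun L hL h0 hLT =>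
    le_antisymm hL (hKmin ⟨hL.trans hKW, h0, hLT⟩ hL)
  have : Nontrivial K := Submodule.nontrivial_iff_ne_bot.mpr hK
  let H : Submodule ℂ (K →ₗ[ℂ] E) :=
    { carrier := {f | (∀ k (x : K), f ⟨T k x, hKT k x x.2⟩ = T k (f x)) ∧ ∀ x, f x ∈ W}
      add_mem' := fun hf hg => ⟨fun k x => by simp [hf.1, hg.1],
        fun x => W.add_mem (hf.2 x) (hg.2 x)⟩
      zero_mem' := ⟨fun k x => by simp, fun x => W.zero_mem⟩
      smul_mem' := fun r f hf => ⟨fun k x => by simp [hf.1], fun x => W.smul_mem r (hf.2 x)⟩ }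
  have hSH : ∀ k, ∀ f ∈ H, S k ∘ₗ f ∈ H := fun k f hf =>
    ⟨fun k' x => by simp [hf.1, hTS], fun x => hWS k _ (hf.2 x)⟩
  let u := stdOrthonormalBasis ℂ K
  have hm : 0 < Module.finrank ℂ K := Module.finrank_pos
  let e₀ : K := u ⟨0, hm⟩
  have he₀ : ⟪(e₀ : E), e₀⟫_ℂ = 1 := by
    rw [← Submodule.coe_inner, inner_self_eq_norm_sq_to_K, u.orthonormal.1]
    simp
  have hschur : ∀ f ∈ H, ∀ g ∈ H, ∀ x y : K, ⟪f x, g y⟫_ℂ = ⟪f e₀, g e₀⟫_ℂ * ⟪x, y⟫_ℂ := by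
    intro f hf g hg x y
    obtain ⟨z, hz⟩ := exists_inner_intertwiners_eq_smul T hT K hK hKT hmin f g hf.1 hg.1
    rw [hz, hz, he₀, mul_one, Submodule.coe_inner]
  have heval : ∀ f ∈ H, f e₀ = 0 → f = 0 := by
    intro f hf h0
    ext x
    have := hschur f hf f hf x x
    rw [h0, inner_zero_left, zero_mul, inner_self_eq_zero] at this
    simpa using this
  let N : Submodule ℂ E := H.map (LinearMap.applyₗ e₀)
  let v := stdOrthonormalBasis ℂ N
  have hv : ∀ ν, ∃ f ∈ H, f e₀ = v ν := fun ν => (v ν).2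
  choose f hfH hf using hv
  have hN : 0 < Module.finrank ℂ N := by
    have : Nontrivial N := by
      refine ⟨⟨⟨e₀, K.subtype, ⟨fun k x => rfl, fun x => hKW x.2⟩, rfl⟩, 0, fun h => ?_⟩⟩
      have h' : (e₀ : E) = 0 := congrArg Subtype.val h
      simp [h'] at he₀
    exact Module.finrank_pos
  refine ⟨_, _, fun p => f p.2 (u p.1), hm, hN, ?_, fun p => (hfH p.2).2 _, fun k => ?_,
    fun k => ?_⟩
  · classical
    rw [orthonormal_iff_ite]
    rintro ⟨μ, ν⟩ ⟨μ', ν'⟩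
    rw [hschur _ (hfH ν) _ (hfH ν'), hf, hf, ← Submodule.coe_inner,
      orthonormal_iff_ite.mp v.orthonormal, orthonormal_iff_ite.mp u.orthonormal]
    by_cases h₁ : ν = ν' <;> by_cases h₂ : μ = μ' <;> simp [h₁, h₂]
  · refine ⟨fun μ' μ => u.repr ⟨T k (u μ), hKT k _ (u μ).2⟩ μ', fun μ ν => ?_⟩
    simp only
    rw [← (hfH ν).1]
    conv_lhs => rw [← u.sum_repr ⟨T k (u μ), hKT k _ (u μ).2⟩]
    simp
  · have hSN : ∀ ν, S k (f ν e₀) ∈ N := fun ν => ⟨S k ∘ₗ f ν, hSH k _ (hfH ν), rfl⟩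
    refine ⟨fun ν' ν => v.repr ⟨S k (f ν e₀), hSN ν⟩ ν', fun μ ν => ?_⟩
    have key : S k ∘ₗ f ν - ∑ ν', v.repr ⟨S k (f ν e₀), hSN ν⟩ ν' • f ν' = 0 := by
      refine heval _ (H.sub_mem (hSH k _ (hfH ν))
        (H.sum_mem fun ν' _ => H.smul_mem _ (hfH ν'))) ?_
      have := congrArg Subtype.val (v.sum_repr ⟨S k (f ν e₀), hSN ν⟩)
      simp only [Submodule.coe_sum, Submodule.coe_smul] at this
      simp only [LinearMap.sub_apply, LinearMap.sum_apply, LinearMap.smul_apply,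
        LinearMap.comp_apply]
      rw [sub_eq_zero]
      exact this.symm.trans (Finset.sum_congr rfl fun ν' _ =>
        congrArg (_ • ·) (hf ν').symm)
    have := congrArg (fun g : K →ₗ[ℂ] E => g (u μ)) (sub_eq_zero.mp key)
    simpa [LinearMap.sum_apply] using this

open scoped InnerProductSpace in
/-- Two commuting families of operators, each closed under adjoints, act on separate tensor
factors of the summands of an orthogonal direct sum decomposition. -/
theorem exists_orthonormal_block_family {κ κ' : Type*} (T : κ → E →ₗ[ℂ] E) (S : κ' → E →ₗ[ℂ] E)
    (hT : ∀ k, ∃ k', ∀ x y, ⟪T k x, y⟫_ℂ = ⟪x, T k' y⟫_ℂ)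
    (hS : ∀ k, ∃ k', ∀ x y, ⟪S k x, y⟫_ℂ = ⟪x, S k' y⟫_ℂ)
    (hTS : ∀ k k' x, T k (S k' x) = S k' (T k x))
    (W : Submodule ℂ E) (hWT : ∀ k, ∀ x ∈ W, T k x ∈ W) (hWS : ∀ k, ∀ x ∈ W, S k x ∈ W) :
    ∃ (ι : Type) (_ : Fintype ι) (_ : DecidableEq ι) (m n : ι → ℕ)
      (e : ∀ i, Fin (m i) × Fin (n i) → E), (∀ i, 0 < m i) ∧ (∀ i, 0 < n i) ∧
      Orthonormal ℂ (fun s : Σ i, Fin (m i) × Fin (n i) => e s.1 s.2) ∧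
      Submodule.span ℂ (Set.range fun s : Σ i, Fin (m i) × Fin (n i) => e s.1 s.2) = W ∧
      (∀ k, ∃ t : ∀ i, Matrix (Fin (m i)) (Fin (m i)) ℂ, ∀ i μ ν,
        T k (e i (μ, ν)) = ∑ μ', t i μ' μ • e i (μ', ν)) ∧
      (∀ k, ∃ s : ∀ i, Matrix (Fin (n i)) (Fin (n i)) ℂ, ∀ i μ ν,
        S k (e i (μ, ν)) = ∑ ν', s i ν' ν • e i (μ, ν')) := by
  induction hd : Module.finrank ℂ W using Nat.strong_induction_on generalizing W with
  | _ r ih =>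
  by_cases hW : W = ⊥
  · subst hW
    exact ⟨Empty, inferInstance, inferInstance, Empty.elim, Empty.elim, fun i => i.elim,
      fun i => i.elim, fun i => i.elim, ⟨fun s => s.1.elim, fun s => s.1.elim⟩, by simp,
      fun k => ⟨fun i => i.elim, fun i => i.elim⟩, fun k => ⟨fun i => i.elim, fun i => i.elim⟩⟩
  obtain ⟨m₀, n₀, e₀, hm₀, hn₀, ho₀, he₀, ht₀, hs₀⟩ :=
    exists_isotypic_component T S hT hTS W hW hWT hWS
  set M := Submodule.span ℂ (Set.range e₀) with hM
  have hMW : M ≤ W := Submodule.span_le.mpr (Set.range_subset_iff.mpr he₀)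
  have hMT : ∀ k, ∀ x ∈ M, T k x ∈ M := fun k => by
    obtain ⟨t, ht⟩ := ht₀ k
    suffices M ≤ M.comap (T k) from this
    refine Submodule.span_le.mpr (Set.range_subset_iff.mpr fun p => ?_)
    rw [SetLike.mem_coe, Submodule.mem_comap, ht]
    exact M.sum_mem fun _ _ => M.smul_mem _ (Submodule.subset_span ⟨_, rfl⟩)
  have hMS : ∀ k, ∀ x ∈ M, S k x ∈ M := fun k => by
    obtain ⟨t, ht⟩ := hs₀ k
    suffices M ≤ M.comap (S k) from this
    refine Submodule.span_le.mpr (Set.range_subset_iff.mpr fun p => ?_)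
    rw [SetLike.mem_coe, Submodule.mem_comap, ht]
    exact M.sum_mem fun _ _ => M.smul_mem _ (Submodule.subset_span ⟨_, rfl⟩)
  have hlt : Module.finrank ℂ ↥(Mᗮ ⊓ W) < r := by
    have h := Submodule.finrank_add_inf_finrank_orthogonal hMW
    have hpos : 0 < Module.finrank ℂ M := by
      rw [hM, finrank_span_eq_card ho₀.linearIndependent]
      simp [hm₀, hn₀]
    omega
  have horth : ∀ R : E →ₗ[ℂ] E, (∃ R' : E →ₗ[ℂ] E, (∀ x ∈ M, R' x ∈ M) ∧
      ∀ x y, ⟪R x, y⟫_ℂ = ⟪x, R' y⟫_ℂ) → ∀ x ∈ Mᗮ, R x ∈ Mᗮ := by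
    rintro R ⟨R', hR', hadj⟩ x hx
    rw [Submodule.mem_orthogonal'] at hx ⊢
    intro y hy
    rw [hadj, hx _ (hR' y hy)]
  obtain ⟨ι, _, _, m, n, e, hm, hn, ho, hspan, ht, hs⟩ := ih _ hlt (Mᗮ ⊓ W)
    (fun k x hx => ⟨horth _ (let ⟨k', h⟩ := hT k; ⟨T k', hMT k', h⟩) x hx.1, hWT k x hx.2⟩)
    (fun k x hx => ⟨horth _ (let ⟨k', h⟩ := hS k; ⟨S k', hMS k', h⟩) x hx.1, hWS k x hx.2⟩) rfl
  have hMe : ∀ i p q, ⟪e₀ p, e i q⟫_ℂ = 0 := fun i p q => by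
    have h : e i q ∈ Mᗮ ⊓ W := hspan ▸ Submodule.subset_span ⟨⟨i, q⟩, rfl⟩
    exact h.1 _ (Submodule.subset_span ⟨p, rfl⟩)
  have hsup : M ⊔ (Mᗮ ⊓ W) = W := Submodule.sup_orthogonal_inf_of_hasOrthogonalProjection hMW
  refine ⟨Option ι, inferInstance, inferInstance, fun o => o.elim m₀ m, fun o => o.elim n₀ n,
    fun o => match o with
      | none => e₀
      | some i => e i,
    fun o => ?_, fun o => ?_, ⟨?_, ?_⟩, ?_, fun k => ?_, fun k => ?_⟩
  · cases o; exacts [hm₀, hm _]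
  · cases o; exacts [hn₀, hn _]
  · rintro ⟨_ | i, p⟩
    exacts [ho₀.1 p, ho.1 ⟨i, p⟩]
  · rintro ⟨_ | i, p⟩ ⟨_ | j, q⟩ hne
    · exact ho₀.2 fun h => hne (congrArg _ h)
    · exact hMe _ _ _
    · exact inner_eq_zero_symm.mp (hMe _ _ _)
    · refine ho.2 (i := ⟨i, p⟩) (j := ⟨j, q⟩) fun h => hne ?_
      cases h
      rfl
  · refine le_antisymm (Submodule.span_le.mpr ?_) ?_
    · rintro _ ⟨⟨_ | i, p⟩, rfl⟩
      · exact he₀ p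
      · exact (hspan.le (Submodule.subset_span ⟨⟨i, p⟩, rfl⟩)).2
    · rw [← hsup, ← hspan]
      refine sup_le (Submodule.span_mono ?_) (Submodule.span_mono ?_)
      · rintro _ ⟨p, rfl⟩
        exact ⟨⟨none, p⟩, rfl⟩
      · rintro _ ⟨⟨i, p⟩, rfl⟩
        exact ⟨⟨some i, p⟩, rfl⟩
  · obtain ⟨t₀, ht₀⟩ := ht₀ k
    obtain ⟨t, ht⟩ := ht k
    refine ⟨fun o => match o with
      | none => t₀
      | some i => t i, fun o => ?_⟩
    cases o
    exacts [ht₀, ht _]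
  · obtain ⟨s₀, hs₀⟩ := hs₀ k
    obtain ⟨s, hs⟩ := hs k
    refine ⟨fun o => match o with
      | none => s₀
      | some i => s i, fun o => ?_⟩
    cases o
    exacts [hs₀, hs _]
end

theorem ptrace₁_margB {x y z : Type*} [Fintype x] [Fintype y]
    (ρ : Matrix ((x × y) × z) ((x × y) × z) ℂ) :
    ptrace₁ (margB ρ) = ptrace₁ ρ := by
  ext i i'
  simp [ptrace₁, margB, Fintype.sum_prod_type]

theorem ptrace₁_margC {x y z : Type*} [Fintype x] [Fintype y]
    (ρ : Matrix ((x × y) × z) ((x × y) × z) ℂ) :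
    ptrace₁ (margC ρ) = ptrace₁ ρ := by
  ext i i'
  simp only [ptrace₁, margC, Fintype.sum_prod_type, Matrix.of_apply]
  exact Finset.sum_comm

theorem IsCJChannel.margB {x y z : Type*} [Fintype x] [Fintype y] [Fintype z] [DecidableEq z]
    {ρ : Matrix ((x × y) × z) ((x × y) × z) ℂ} (h : IsCJChannel ρ) :
    IsCJChannel (margB ρ) := by
  refine ⟨?_, (ptrace₁_margB ρ).trans h.2⟩
  have : _root_.margB ρ = ∑ γ, ρ.submatrix (fun p : x × z => ((p.1, γ), p.2))
      (fun p : x × z => ((p.1, γ), p.2)) := by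
    ext p q
    simp [_root_.margB, Matrix.sum_apply]
  rw [this]
  exact posSemidef_sum _ fun γ _ => h.1.submatrix _

theorem IsCJChannel.margC {x y z : Type*} [Fintype x] [Fintype y] [Fintype z] [DecidableEq z]
    {ρ : Matrix ((x × y) × z) ((x × y) × z) ℂ} (h : IsCJChannel ρ) :
    IsCJChannel (margC ρ) := by
  refine ⟨?_, (ptrace₁_margC ρ).trans h.2⟩
  have : _root_.margC ρ = ∑ β, ρ.submatrix (fun p : y × z => ((β, p.1), p.2))
      (fun p : y × z => ((β, p.1), p.2)) := by
    ext p q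
    simp [_root_.margC, Matrix.sum_apply]
  rw [this]
  exact posSemidef_sum _ fun γ _ => h.1.submatrix _

theorem IsCJChannel.submatrix_input {o x y : Type*} [Fintype o] [Fintype x] [Fintype y]
    [DecidableEq x] [DecidableEq y] {M : Matrix (o × x) (o × x) ℂ} (h : IsCJChannel M)
    {j : y → x} (hj : Function.Injective j) :
    IsCJChannel (M.submatrix (Prod.map id j) (Prod.map id j)) := by
  refine ⟨h.1.submatrix _, ?_⟩
  ext i i'
  have := congrFun₂ h.2 (j i) (j i')
  simpa [ptrace₁, one_apply, hj.eq_iff] using this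

theorem IsCJChannel.conjOnA {o x y : Type*} [Fintype o] [Fintype x] [Fintype y]
    [DecidableEq x] [DecidableEq y] {M : Matrix (o × x) (o × x) ℂ} (h : IsCJChannel M)
    {V : Matrix y x ℂ} (hV : V * Vᴴ = 1) : IsCJChannel (conjOnA M V) := by
  classical
  constructor
  · have : _root_.conjOnA M V = (kroneckerMap (· * ·) (1 : Matrix o o ℂ) V) * M *
        (kroneckerMap (· * ·) (1 : Matrix o o ℂ) V)ᴴ := by
      ext ⟨p, s⟩ ⟨q, t⟩
      simp only [_root_.conjOnA, Matrix.mul_apply, Matrix.of_apply, Fintype.sum_prod_type,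
        kroneckerMap_apply, one_apply, conjTranspose_apply, Finset.sum_mul]
      simp only [apply_ite star, star_zero, ite_mul, mul_ite, one_mul, zero_mul, mul_zero,
        Finset.sum_ite_irrel, Finset.sum_const_zero, Finset.sum_ite_eq, Finset.mem_univ, if_true]
      exact Finset.sum_comm
    rw [this]
    exact h.1.mul_mul_conjTranspose_same _
  · have : ptrace₁ (_root_.conjOnA M V) = V * ptrace₁ M * Vᴴ := by
      ext s t
      simp only [_root_.conjOnA, ptrace₁, Matrix.mul_apply, Matrix.of_apply,
        conjTranspose_apply, Finset.sum_mul, Finset.mul_sum]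
      rw [Finset.sum_comm]
      conv_rhs => rw [Finset.sum_comm]
      exact Finset.sum_congr rfl fun i _ => Finset.sum_comm
    rw [this, h.2, Matrix.mul_one, hV]

open scoped InnerProductSpace in
theorem conjOnA_eq_inner {o x y : Type*} [Fintype x] [DecidableEq x]
    (M : Matrix (o × x) (o × x) ℂ) (e : y → EuclideanSpace ℂ x) (p q : o) (s t : y) :
    conjOnA M (Matrix.of fun s i => e s i) (p, s) (q, t) =
      ⟪e t, toEuclideanLin (Matrix.of fun i' i => M (p, i) (q, i')) (e s)⟫_ℂ := by
  simp only [conjOnA, PiLp.inner_apply, Matrix.mulVec, dotProduct, Finset.sum_mul, toLpLin_apply,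
    Matrix.of_apply, RCLike.inner_apply]
  rw [Finset.sum_comm]
  refine Finset.sum_congr rfl fun i _ => Finset.sum_congr rfl fun j _ => ?_
  rw [starRingEnd_apply]
  ring

open scoped Kronecker in
/-- The channel of a common-cause dilation is a product of two commuting unital families. -/
theorem CommonCauseDilation.exists_commuting_factors {b c a : Type*} [Fintype b] [Fintype c]
    [Fintype a] [DecidableEq a] [DecidableEq b] [DecidableEq c]
    {ρ : Matrix ((b × c) × a) ((b × c) × a) ℂ} (D : CommonCauseDilation ρ) :
    ∃ (T : b → b → Matrix a a ℂ) (S : c → c → Matrix a a ℂ),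
      (∀ β β' γ γ', T β β' * S γ γ' = S γ γ' * T β β') ∧
      ∑ β, T β β = 1 ∧ ∑ γ, S γ γ = 1 ∧
      ∀ β β' γ γ' i i', ρ ((β, γ), i) ((β', γ'), i') = (T β β' * S γ γ') i' i := by
  obtain ⟨lB, lC, d, -, U, hU, rB, rC, ⟨-, hrB⟩, ⟨-, hrC⟩, hind, ⟨σ, hσ⟩, ⟨τ, hτ⟩⟩ := D
  let PB : b → b → Matrix (b × d × c) (b × d × c) ℂ := fun β β' =>
    single β' β 1 ⊗ₖ 1
  let PC : c → c → Matrix (b × d × c) (b × d × c) ℂ := fun γ γ' =>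
    1 ⊗ₖ (1 ⊗ₖ single γ' γ 1)
  have hP : ∀ β β' γ γ', PB β β' * PC γ γ' = PC γ γ' * PB β β' := fun β β' γ γ' => by
    simp only [PB, PC, ← mul_kronecker_mul, Matrix.one_mul, Matrix.mul_one]
  have hPB : ∀ β β' (M : Matrix (b × d × c) (lB × a × lC) ℂ) p x,
      (PB β β' * M) p x = if p.1 = β' then M (β, p.2) x else 0 := by
    rintro β β' M ⟨β₁, δ, γ⟩ x
    rw [Matrix.mul_apply, Finset.sum_eq_single (β, δ, γ)]
    · simp [PB, single_apply, eq_comm]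
    · rintro ⟨β₂, δ', γ'⟩ - hne
      simp only [PB, kroneckerMap_apply, one_apply, single_apply]
      grind
    · simp
  have hPC : ∀ γ γ' (M : Matrix (b × d × c) (lB × a × lC) ℂ) p x,
      (PC γ γ' * M) p x = if p.2.2 = γ' then M (p.1, p.2.1, γ) x else 0 := by
    rintro γ γ' M ⟨β, δ, γ₁⟩ x
    rw [Matrix.mul_apply, Finset.sum_eq_single (β, δ, γ)]
    · simp [PC, single_apply, eq_comm]
    · rintro ⟨β₂, δ', γ'⟩ - hne
      simp only [PC, kroneckerMap_apply, one_apply, single_apply]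
      grind
    · simp
  let Y : b → b → Matrix (lB × a × lC) (lB × a × lC) ℂ := fun β β' => Uᴴ * PB β β' * U
  let X : c → c → Matrix (lB × a × lC) (lB × a × lC) ℂ := fun γ γ' => Uᴴ * PC γ γ' * U
  have hYX : ∀ β β' γ γ', Y β β' * X γ γ' = Uᴴ * (PB β β' * PC γ γ') * U :=
    fun β β' γ γ' => by
      simp only [X, Y, Matrix.mul_assoc]
      rw [← Matrix.mul_assoc U, hU.1, Matrix.one_mul]
  have hXY : ∀ β β' γ γ', X γ γ' * Y β β' = Y β β' * X γ γ' := fun β β' γ γ' => by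
    rw [hYX, hP]
    simp only [X, Y, Matrix.mul_assoc]
    rw [← Matrix.mul_assoc U, hU.1, Matrix.one_mul]
  have hYτ : ∀ β β' l l' i i' m m', Y β β' (l', i', m') (l, i, m) =
      (if m = m' then 1 else 0) * τ (β, (l, i)) (β', (l', i')) := by
    intro β β' l l' i i' m m'
    rw [← hτ]
    simp [Y, cjOf, Matrix.mul_assoc, Matrix.mul_apply (M := Uᴴ), hPB, Fintype.sum_prod_type,
      Finset.sum_ite_irrel, mul_comm]
  have hXσ : ∀ γ γ' l l' i i' m m', X γ γ' (l', i', m') (l, i, m) =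
      (if l = l' then 1 else 0) * σ (γ, (i, m)) (γ', (i', m')) := by
    intro γ γ' l l' i i' m m'
    rw [← hσ]
    simp [X, cjOf, Matrix.mul_assoc, Matrix.mul_apply (M := Uᴴ), hPC, Fintype.sum_prod_type,
      mul_comm]
  have hYXU : ∀ β β' γ γ' l l' i i' m m', (Y β β' * X γ γ') (l', i', m') (l, i, m) =
      ∑ δ, U (β, δ, γ) (l, i, m) * star (U (β', δ, γ') (l', i', m')) := by
    intro β β' γ γ' l l' i i' m m'
    rw [hYX]
    simp [Matrix.mul_assoc, Matrix.mul_apply (M := Uᴴ), hPB, hPC, Fintype.sum_prod_type,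
      Finset.sum_ite_irrel, mul_comm]
  have hYXτσ : ∀ β β' γ γ' l l' i i' m m', (Y β β' * X γ γ') (l', i', m') (l, i, m) =
      ∑ k, τ (β, (l, k)) (β', (l', i')) * σ (γ, (i, m)) (γ', (k, m')) := by
    intro β β' γ γ' l l' i i' m m'
    simp [Matrix.mul_apply, Fintype.sum_prod_type, hYτ, hXσ]
  have hXYτσ : ∀ β β' γ γ' l l' i i' m m', (X γ γ' * Y β β') (l', i', m') (l, i, m) =
      ∑ k, σ (γ, (k, m)) (γ', (i', m')) * τ (β, (l, i)) (β', (l', k)) := by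
    intro β β' γ γ' l l' i i' m m'
    simp [Matrix.mul_apply, Fintype.sum_prod_type, hYτ, hXσ]
  have hτ1 : ∀ l l' i i', ∑ β, τ (β, (l, i)) (β, (l', i')) =
      if l = l' then if i = i' then 1 else 0 else 0 := by
    intro l l' i i'
    obtain ⟨m⟩ := ‹Nonempty lC›
    have h := congrFun₂ hU.2 (l', i', m) (l, i, m)
    have h' : ∀ β, ∑ δ, ∑ γ, cjOf U ((β, δ, γ), (l, i, m)) ((β, δ, γ), (l', i', m)) =
      τ (β, (l, i)) (β, (l', i')) := fun β => by simp [hτ]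
    simp only [← h']
    refine Eq.trans ?_ (h.trans ?_)
    · simp [Matrix.mul_apply, Fintype.sum_prod_type, cjOf, mul_comm]
    · rw [one_apply]
      grind
  have hσ1 : ∀ m m' i i', ∑ γ, σ (γ, (i, m)) (γ, (i', m')) =
      if m = m' then if i = i' then 1 else 0 else 0 := by
    intro m m' i i'
    obtain ⟨l⟩ := ‹Nonempty lB›
    have h := congrFun₂ hU.2 (l, i', m') (l, i, m)
    have h' : ∀ γ, ∑ β, ∑ δ, cjOf U ((β, δ, γ), (l, i, m)) ((β, δ, γ), (l, i', m')) =
      σ (γ, (i, m)) (γ, (i', m')) := fun γ => by simp [hσ]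
    simp only [← h']
    rw [Finset.sum_comm]
    simp only [Finset.sum_comm (s := (Finset.univ : Finset c))]
    refine Eq.trans ?_ (h.trans ?_)
    · simp [Matrix.mul_apply, Fintype.sum_prod_type, cjOf, mul_comm]
    · rw [one_apply]
      grind
  let T : b → b → Matrix a a ℂ := fun β β' => Matrix.of fun i' i =>
    ∑ l, ∑ l', rB l l' * τ (β, (l, i)) (β', (l', i'))
  let S : c → c → Matrix a a ℂ := fun γ γ' => Matrix.of fun i' i =>
    ∑ m, ∑ m', rC m m' * σ (γ, (i, m)) (γ', (i', m'))
  have hTS : ∀ β β' γ γ' i i', (T β β' * S γ γ') i' i = ∑ l, ∑ l', ∑ m, ∑ m',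
      rB l l' * rC m m' * (Y β β' * X γ γ') (l', i', m') (l, i, m) := by
    intro β β' γ γ' i i'
    simp only [hYXτσ, T, S, Matrix.mul_apply, Matrix.of_apply, Finset.sum_mul]
    simp only [Finset.mul_sum]
    rw [Finset.sum_comm]
    refine Finset.sum_congr rfl fun l _ => ?_
    rw [Finset.sum_comm]
    refine Finset.sum_congr rfl fun l' _ => ?_
    rw [Finset.sum_comm]
    refine Finset.sum_congr rfl fun m _ => ?_
    rw [Finset.sum_comm]
    refine Finset.sum_congr rfl fun m' _ => Finset.sum_congr rfl fun k _ => ?_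
    ring
  have hST : ∀ β β' γ γ' i i', (S γ γ' * T β β') i' i = ∑ l, ∑ l', ∑ m, ∑ m',
      rB l l' * rC m m' * (X γ γ' * Y β β') (l', i', m') (l, i, m) := by
    intro β β' γ γ' i i'
    simp only [hXYτσ, T, S, Matrix.mul_apply, Matrix.of_apply, Finset.mul_sum]
    simp only [Finset.sum_mul]
    rw [Finset.sum_comm]
    refine Finset.sum_congr rfl fun l _ => ?_
    rw [Finset.sum_comm]
    refine Finset.sum_congr rfl fun l' _ => ?_
    rw [Finset.sum_comm]
    refine Finset.sum_congr rfl fun m _ => ?_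
    rw [Finset.sum_comm]
    refine Finset.sum_congr rfl fun m' _ => Finset.sum_congr rfl fun k _ => ?_
    ring
  have hrB' : ∑ l, rB l l = 1 := hrB
  have hrC' : ∑ m, rC m m = 1 := hrC
  refine ⟨T, S, fun β β' γ γ' => ?_, ?_, ?_, fun β β' γ γ' i i' => ?_⟩
  · ext i' i
    rw [hTS, hST]
    simp only [hXY]
  · ext i' i
    simp only [Matrix.sum_apply, T, Matrix.of_apply]
    rw [Finset.sum_comm]
    simp only [Finset.sum_comm (s := (Finset.univ : Finset b)), ← Finset.mul_sum, hτ1]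
    simp [Finset.sum_ite_irrel, one_apply, hrB', eq_comm]
  · ext i' i
    simp only [Matrix.sum_apply, S, Matrix.of_apply]
    rw [Finset.sum_comm]
    simp only [Finset.sum_comm (s := (Finset.univ : Finset c)), ← Finset.mul_sum, hσ1]
    simp [Finset.sum_ite_irrel, one_apply, hrC', eq_comm]
  · rw [hind, hTS]
    simp only [hYXU, Finset.mul_sum]
    rw [Finset.sum_comm]
    refine Finset.sum_congr rfl fun l _ => ?_
    rw [Finset.sum_comm]
    refine Finset.sum_congr rfl fun l' _ => ?_
    rw [Finset.sum_comm]
    refine Finset.sum_congr rfl fun m _ => ?_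
    rw [Finset.sum_comm]
    refine Finset.sum_congr rfl fun m' _ => Finset.sum_congr rfl fun k _ => ?_
    ring
/-- Theorem 2/3, 1 ⇒ 4: a channel operator admitting a common-cause dilation admits a
common-cause block form. -/
theorem dilation_implies_blockform (ρ : Matrix ((b × c) × a) ((b × c) × a) ℂ)
    (hρ : IsCJChannel ρ) (D : CommonCauseDilation ρ) :
    Nonempty (CommonCauseBlockForm ρ) := by
  obtain ⟨T, S, hTS, hT1, hS1, hρTS⟩ := D.exists_commuting_factors
  have hmargB : ∀ β β' i i', margB ρ (β, i) (β', i') = T β β' i' i := fun β β' i i' => by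
    simp only [margB, Matrix.of_apply, hρTS]
    rw [← Matrix.sum_apply, ← Finset.mul_sum, hS1, mul_one]
  have hmargC : ∀ γ γ' i i', margC ρ (γ, i) (γ', i') = S γ γ' i' i := fun γ γ' i i' => by
    simp only [margC, Matrix.of_apply, hρTS]
    rw [← Matrix.sum_apply, ← Finset.sum_mul, hT1, one_mul]
  have hTadj : ∀ β β', (T β β')ᴴ = T β' β := fun β β' => by
    ext i i'
    rw [conjTranspose_apply, ← hmargB, ← hmargB, hρ.margB.1.isHermitian.apply]
  have hSadj : ∀ γ γ', (S γ γ')ᴴ = S γ' γ := fun γ γ' => by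
    ext i i'
    rw [conjTranspose_apply, ← hmargC, ← hmargC, hρ.margC.1.isHermitian.apply]
  obtain ⟨ι, _, _, m, n, e, hm, hn, ho, hspan, ht, hs⟩ := exists_orthonormal_block_family
    (fun k : b × b => toEuclideanLin (T k.1 k.2)) (fun k : c × c => toEuclideanLin (S k.1 k.2))
    (fun k => ⟨k.swap, fun x y => by
      rw [Prod.fst_swap, Prod.snd_swap, ← hTadj, toEuclideanLin_conjTranspose_eq_adjoint,
        LinearMap.adjoint_inner_left]⟩)
    (fun k => ⟨k.swap, fun x y => by
      rw [Prod.fst_swap, Prod.snd_swap, ← hSadj, toEuclideanLin_conjTranspose_eq_adjoint,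
        LinearMap.adjoint_inner_left]⟩)
    (fun k k' x => by
      rw [← LinearMap.comp_apply, ← LinearMap.comp_apply, ← toLpLin_mul_same,
        ← toLpLin_mul_same, hTS])
    ⊤ (fun _ _ _ => trivial) (fun _ _ _ => trivial)
  choose t ht using ht
  choose s hs using hs
  let e' : (Σ i, Fin (m i) × Fin (n i)) → EuclideanSpace ℂ a := fun s => e s.1 s.2
  have he' : ∀ i p, e' ⟨i, p⟩ = e i p := fun _ _ => rfl
  let V : Matrix (Σ i, Fin (m i) × Fin (n i)) a ℂ := Matrix.of fun s i => e' s i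
  have hcard : Fintype.card (Σ i, Fin (m i) × Fin (n i)) = Fintype.card a := by
    rw [← Module.finrank_eq_card_basis (OrthonormalBasis.mk ho hspan.ge).toBasis,
      finrank_euclideanSpace]
  have hinner : ∀ p q, inner ℂ (e' p) (e' q) = if p = q then 1 else 0 := orthonormal_iff_ite.mp ho
  have hV : V * Vᴴ = 1 := by
    ext p q
    rw [one_apply, Matrix.mul_apply]
    simpa [V, PiLp.inner_apply, eq_comm] using hinner q p
  let j : ∀ i, Fin (m i) → Σ i, Fin (m i) × Fin (n i) := fun i μ => ⟨i, (μ, ⟨0, hn i⟩)⟩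
  let k : ∀ i, Fin (n i) → Σ i, Fin (m i) × Fin (n i) := fun i ν => ⟨i, (⟨0, hm i⟩, ν)⟩
  have hj : ∀ i, Function.Injective (j i) := fun i μ μ' h => by simpa [j] using h
  have hk : ∀ i, Function.Injective (k i) := fun i μ μ' h => by simpa [k] using h
  have hB : ∀ i μ μ' β β', conjOnA (margB ρ) V (β, j i μ) (β', j i μ') = t (β, β') i μ' μ := by
    intro i μ μ' β β'
    have : (Matrix.of fun i' i => margB ρ (β, i) (β', i')) = T β β' := by
      ext i' i
      exact hmargB ..
    rw [conjOnA_eq_inner, this]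
    simp only [j, he', ht (β, β')]
    simp only [← he', inner_sum, inner_smul_right, hinner]
    simp
  have hC : ∀ i ν ν' γ γ', conjOnA (margC ρ) V (γ, k i ν) (γ', k i ν') = s (γ, γ') i ν' ν := by
    intro i ν ν' γ γ'
    have : (Matrix.of fun i' i => margC ρ (γ, i) (γ', i')) = S γ γ' := by
      ext i' i
      exact hmargC ..
    rw [conjOnA_eq_inner, this]
    simp only [k, he', hs (γ, γ')]
    simp only [← he', inner_sum, inner_smul_right, hinner]
    simp
  have hBC : ∀ i μ ν q β β' γ γ', conjOnA ρ V ((β, γ), ⟨i, (μ, ν)⟩) ((β', γ'), q) =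
      ∑ ν', ∑ μ', s (γ, γ') i ν' ν * t (β, β') i μ' μ * inner ℂ (e' q) (e' ⟨i, (μ', ν')⟩) := by
    intro i μ ν q β β' γ γ'
    have : (Matrix.of fun i' i => ρ ((β, γ), i) ((β', γ'), i')) = T β β' * S γ γ' := by
      ext i' i
      exact hρTS ..
    rw [conjOnA_eq_inner, this, toLpLin_mul_same, LinearMap.comp_apply, he', hs (γ, γ'), map_sum]
    simp only [map_smul, ht (β, β'), Finset.smul_sum, smul_smul, inner_sum, inner_smul_right, he']
  exact ⟨{
    ι := ι
    m := m
    n := n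
    card_eq := by simpa using hcard
    V := V
    hV := ⟨hV, (mul_eq_one_comm_of_card_eq _ _ _ hcard).mp hV⟩
    ρB := fun i => (conjOnA (margB ρ) V).submatrix (Prod.map id (j i)) (Prod.map id (j i))
    ρC := fun i => (conjOnA (margC ρ) V).submatrix (Prod.map id (k i)) (Prod.map id (k i))
    hρB := fun i => (hρ.margB.conjOnA hV).submatrix_input (hj i)
    hρC := fun i => (hρ.margC.conjOnA hV).submatrix_input (hk i)
    offdiag := by
      rintro β β' γ γ' ⟨i, μ, ν⟩ q hne
      rw [hBC]
      refine Finset.sum_eq_zero fun ν' _ => Finset.sum_eq_zero fun μ' _ => ?_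
      rw [hinner, if_neg, mul_zero]
      rintro rfl
      exact hne rfl
    diag := by
      intro i μ μ' ν ν' β β' γ γ'
      simp only [submatrix_apply, Prod.map_apply, id_eq, hB, hC, hBC, hinner]
      rw [Finset.sum_eq_single ν', Finset.sum_eq_single μ']
      · simp [mul_comm]
      · intro μ'' _ h
        simp [h.symm]
      · simp
      · intro ν'' _ h
        simp [h.symm]
      · simp }⟩

end
end
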